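/- Let (W,S) be a Coxeter system and n ≥ 0. Suppose A is a maximal (n+1)-spherical special subgroup of W (i.e., an (n+1)-spherical special subgroup not properly contained in any (n+1)-spherical special subgroup), B is an (n+1)-spherical special subgroup of W, and w ∈ W satisfies A ⊆ wBw⁻¹. Then A = wBw⁻¹. In particular, for every w ∈ W, if A ⊆ wAw⁻¹ then A = wAw⁻¹. -/

import Mathlib

open CoxeterSystem

namespace CoxFA

variable {B : Type*}

/-- The special subgroup of `W` generated by the simple reflections indexed by `T`. -/
def sp {W : Type*} [Group W] {M : CoxeterMatrix B} (cs : CoxeterSystem M W) (T : Set B) :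
    Subgroup W :=
  Subgroup.closure (cs.simple '' T)

/-- The conjugate subgroup `w H w⁻¹`. -/
def conjSub {W : Type*} [Group W] (w : W) (H : Subgroup W) : Subgroup W :=
  H.map (MulAut.conj w).toMonoidHom

/-- `(W_T, T)` is `n`-spherical: every special subgroup of `W_T` of rank at most `n`
is finite. -/
def IsSpherical {W : Type*} [Group W] {M : CoxeterMatrix B} (cs : CoxeterSystem M W)
    (n : ℕ) (T : Set B) : Prop :=
  ∀ U : Finset B, ↑U ⊆ T → U.card ≤ n → Finite ↥(sp cs (↑U : Set B))

/-- `W_T` is a maximal `n`-spherical special subgroup: it is `n`-spherical and is not properly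
contained in any `n`-spherical special subgroup. -/
def IsMaxSpherical {W : Type*} [Group W] {M : CoxeterMatrix B} (cs : CoxeterSystem M W)
    (n : ℕ) (T : Set B) : Prop :=
  IsSpherical cs n T ∧ ∀ T' : Set B, IsSpherical cs n T' → ¬ (sp cs T < sp cs T')

section Reflections

open Classical in
/-- The permutation of `W × ZMod 2` given by conjugation by the simple reflection `s i` on the
first factor, flipping the sign exactly at `s i`. -/
noncomputable def signedConj {W : Type*} [Group W] {M : CoxeterMatrix B}
    (cs : CoxeterSystem M W) (i : B) : Equiv.Perm (W × ZMod 2) :=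
  Function.Involutive.toPerm
    (fun p ↦ (cs.simple i * p.1 * cs.simple i, p.2 + if p.1 = cs.simple i then 1 else 0)) (by
      rintro ⟨t, e⟩
      have h : cs.simple i * t * cs.simple i = cs.simple i ↔ t = cs.simple i := by
        rw [mul_eq_right, ← cs.inv_simple i, inv_mul_eq_one, eq_comm, cs.inv_simple]
      have h2 : ∀ a : ZMod 2, a + a = 0 := by decide
      ext
      · simp [mul_assoc]
      · simp only [h, add_assoc, h2, add_zero])

variable {W : Type*} [Group W] {M : CoxeterMatrix B} (cs : CoxeterSystem M W)

open Classical in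
theorem signedConj_apply (i : B) (t : W) (e : ZMod 2) :
    signedConj cs i (t, e) =
      (cs.simple i * t * cs.simple i, e + if t = cs.simple i then 1 else 0) := rfl

open Classical in
theorem signedConj_mul_pow_apply (i j : B) (m : ℕ) (t : W) (e : ZMod 2) :
    ((signedConj cs i * signedConj cs j) ^ m) (t, e) =
      ((cs.simple i * cs.simple j) ^ m * t * ((cs.simple i * cs.simple j) ^ m)⁻¹,
        e + ∑ k ∈ Finset.range (2 * m),
          if t = cs.simple j * (cs.simple i * cs.simple j) ^ k then 1 else 0) := by
  have hp : ∀ k : ℕ, cs.simple j * (cs.simple i * cs.simple j) ^ k =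
      ((cs.simple i * cs.simple j) ^ k)⁻¹ * cs.simple j := by
    intro k
    have h : SemiconjBy (cs.simple j) (cs.simple i * cs.simple j)
        (cs.simple i * cs.simple j)⁻¹ := by
      simp [SemiconjBy, mul_assoc]
    rw [← inv_pow]
    exact (h.pow_right k).eq
  induction m with
  | zero => simp
  | succ m ih =>
    rw [pow_succ', Equiv.Perm.mul_apply, ih, Equiv.Perm.mul_apply, signedConj_apply,
      signedConj_apply]
    set p := cs.simple i * cs.simple j with hpdef
    have e1 : p ^ m * t * (p ^ m)⁻¹ = cs.simple j ↔ t = cs.simple j * p ^ (2 * m) := by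
      rw [two_mul, pow_add, ← mul_assoc, hp, mul_inv_eq_iff_eq_mul, mul_assoc,
        eq_inv_mul_iff_mul_eq]
    have e2 : cs.simple j * (p ^ m * t * (p ^ m)⁻¹) * cs.simple j = cs.simple i ↔
        t = cs.simple j * p ^ (2 * m + 1) := by
      have : cs.simple j * p ^ (2 * m + 1) =
          (p ^ m)⁻¹ * (cs.simple j * cs.simple i * cs.simple j) * p ^ m := by
        rw [show 2 * m + 1 = m + (1 + m) by omega, pow_add, ← mul_assoc, hp, pow_add, pow_one,
          hpdef]
        simp only [mul_assoc]
      rw [this]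
      constructor
      · intro h
        rw [← h]
        simp [mul_assoc]
      · rintro rfl
        simp [mul_assoc]
    rw [show 2 * (m + 1) = 2 * m + 1 + 1 by ring, Finset.sum_range_succ, Finset.sum_range_succ]
    simp only [e1, e2]
    refine Prod.ext ?_ ?_
    · simp [hpdef, pow_succ', mul_assoc]
    · simp only [add_assoc]

theorem isLiftable_signedConj : M.IsLiftable (signedConj cs) := by
  classical
  intro i j
  ext1 ⟨t, e⟩
  have h2 : ∀ a : ZMod 2, a + a = 0 := by decide
  rw [signedConj_mul_pow_apply, two_mul, Finset.sum_range_add]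
  simp only [pow_add, cs.simple_mul_simple_pow, one_mul, h2]
  simp

/-- The action of `W` on signed elements extending `signedConj`. -/
noncomputable def signedAction : W →* Equiv.Perm (W × ZMod 2) :=
  cs.lift ⟨signedConj cs, isLiftable_signedConj cs⟩

theorem signedAction_simple (i : B) : signedAction cs (cs.simple i) = signedConj cs i :=
  cs.lift_apply_simple _ i

open Classical in
theorem signedAction_wordProd (ω : List B) (t : W) (e : ZMod 2) :
    signedAction cs (cs.wordProd ω) (t, e) =
      (cs.wordProd ω * t * (cs.wordProd ω)⁻¹, e + ((cs.rightInvSeq ω).count t : ZMod 2)) := by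
  induction ω with
  | nil => simp
  | cons i ω ih =>
    rw [wordProd_cons, map_mul, Equiv.Perm.mul_apply, ih, signedAction_simple, signedConj_apply,
      rightInvSeq, List.count_cons]
    have : cs.wordProd ω * t * (cs.wordProd ω)⁻¹ = cs.simple i ↔
        (cs.wordProd ω)⁻¹ * cs.simple i * cs.wordProd ω = t := by
      rw [mul_inv_eq_iff_eq_mul, mul_assoc, inv_mul_eq_iff_eq_mul, eq_comm]
    simp only [this, beq_iff_eq]
    refine Prod.ext ?_ ?_
    · simp [mul_assoc]
    · push_cast
      simp [add_assoc]

/-- The sign change of `t` under `w`; for a reflection `t` it detects right inversions. -/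
noncomputable def inversionParity (w t : W) : ZMod 2 := (signedAction cs w (t, 0)).2

theorem signedAction_apply (w t : W) (e : ZMod 2) :
    signedAction cs w (t, e) = (w * t * w⁻¹, e + inversionParity cs w t) := by
  obtain ⟨ω, rfl⟩ := cs.wordProd_surjective w
  simp [inversionParity, signedAction_wordProd]

theorem inversionParity_mul (a b t : W) :
    inversionParity cs (a * b) t = inversionParity cs b t + inversionParity cs a (b * t * b⁻¹) := by
  rw [inversionParity, map_mul, Equiv.Perm.mul_apply, signedAction_apply, signedAction_apply]
  simp

theorem inversionParity_one (t : W) : inversionParity cs 1 t = 0 := by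
  simp [inversionParity]

open Classical in
theorem inversionParity_simple (i : B) (t : W) :
    inversionParity cs (cs.simple i) t = if t = cs.simple i then 1 else 0 := by
  simp [inversionParity, signedAction_simple, signedConj_apply]

theorem inversionParity_self {t : W} (ht : cs.IsReflection t) : inversionParity cs t t = 1 := by
  obtain ⟨u, i, rfl⟩ := ht
  have h := inversionParity_mul cs u u⁻¹ (u * cs.simple i * u⁻¹)
  rw [mul_inv_cancel, inversionParity_one] at h
  rw [inversionParity_mul, inversionParity_mul cs u (cs.simple i)]
  simp only [inv_inv, mul_assoc, inv_mul_cancel_left, inv_mul_cancel, mul_one,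
    one_mul, inversionParity_simple, inv_simple, simple_mul_simple_self] at h ⊢
  rw [add_left_comm, ← h]
  simp

theorem mem_rightInvSeq_of_inversionParity {ω : List B} {t : W}
    (h : inversionParity cs (cs.wordProd ω) t ≠ 0) : t ∈ cs.rightInvSeq ω := by
  classical
  by_contra hn
  apply h
  simp [inversionParity, signedAction_wordProd, List.count_eq_zero_of_not_mem hn]

theorem inversionParity_ne_zero_iff {w t : W} (ht : cs.IsReflection t) :
    inversionParity cs w t ≠ 0 ↔ cs.length (w * t) < cs.length w := by
  have key : ∀ w : W, inversionParity cs w t ≠ 0 → cs.length (w * t) < cs.length w := by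
    intro w h
    obtain ⟨ω, hω, rfl⟩ := cs.exists_isReduced w
    exact (cs.isRightInversion_of_mem_rightInvSeq hω
      (mem_rightInvSeq_of_inversionParity cs h)).2
  refine ⟨key w, fun h h0 ↦ ?_⟩
  have h1 := key (w * t) (by
    rw [inversionParity_mul, inversionParity_self cs ht]
    simp [h0])
  rw [mul_assoc, ht.mul_self, mul_one] at h1
  omega

/-- The strong exchange property. -/
theorem exists_eraseIdx_of_length_lt {ω : List B} {t : W} (ht : cs.IsReflection t)
    (h : cs.length (cs.wordProd ω * t) < cs.length (cs.wordProd ω)) :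
    ∃ j < ω.length, cs.wordProd ω * t = cs.wordProd (ω.eraseIdx j) := by
  have hmem := mem_rightInvSeq_of_inversionParity cs ((inversionParity_ne_zero_iff cs ht).2 h)
  obtain ⟨j, hj, rfl⟩ := List.mem_iff_getElem.1 hmem
  refine ⟨j, by simpa using hj, ?_⟩
  rw [← cs.wordProd_mul_getD_rightInvSeq, List.getD_eq_getElem _ _ hj]

theorem length_mul_simple_lt_of_ne {x t : W} (ht : cs.IsReflection t) {i : B}
    (hti : t ≠ cs.simple i) (h : cs.length x < cs.length (x * t)) :
    cs.length (x * cs.simple i) < cs.length (x * t * cs.simple i) := by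
  have ht' : cs.IsReflection (cs.simple i * t * cs.simple i) := by
    simpa using ht.conj (cs.simple i)
  have e : x * t * cs.simple i = x * cs.simple i * (cs.simple i * t * cs.simple i) := by
    simp [mul_assoc]
  rw [e]
  refine lt_of_le_of_ne (le_of_not_gt fun hlt ↦ ?_) (ht'.length_mul_left_ne _).symm
  refine (inversionParity_ne_zero_iff cs ht').2 hlt ?_
  have hne : ¬ cs.simple i * t * cs.simple i = cs.simple i := by
    rw [mul_eq_right, ← cs.inv_simple i, inv_mul_eq_one]
    exact hti.symm
  rw [inversionParity_mul, inversionParity_simple, if_neg hne]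
  have h0 : inversionParity cs x t = 0 := by
    by_contra h'
    exact absurd ((inversionParity_ne_zero_iff cs ht).1 h') (by omega)
  simpa [mul_assoc] using h0

end Reflections

section SpecialSubgroups

variable {W : Type*} [Group W] {M : CoxeterMatrix B} (cs : CoxeterSystem M W)

theorem simple_mem_sp {T : Set B} {i : B} (hi : i ∈ T) : cs.simple i ∈ sp cs T :=
  Subgroup.subset_closure ⟨i, hi, rfl⟩

theorem sp_mono {T U : Set B} (h : T ⊆ U) : sp cs T ≤ sp cs U :=
  Subgroup.closure_mono (Set.image_mono h)

theorem wordProd_mem_sp {T : Set B} {ω : List B} (h : ∀ i ∈ ω, i ∈ T) :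
    cs.wordProd ω ∈ sp cs T := by
  refine Subgroup.list_prod_mem _ fun x hx ↦ ?_
  obtain ⟨i, hi, rfl⟩ := List.mem_map.1 hx
  exact simple_mem_sp cs (h i hi)

theorem exists_isReduced_of_mem_sp {T : Set B} {w : W} (hw : w ∈ sp cs T) :
    ∃ ω : List B, cs.IsReduced ω ∧ (∀ i ∈ ω, i ∈ T) ∧ w = cs.wordProd ω := by
  have step : ∀ (x : W) (i : B), i ∈ T →
      (∃ ω : List B, cs.IsReduced ω ∧ (∀ i ∈ ω, i ∈ T) ∧ x = cs.wordProd ω) →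
      ∃ ω : List B, cs.IsReduced ω ∧ (∀ i ∈ ω, i ∈ T) ∧ x * cs.simple i = cs.wordProd ω := by
    rintro _ i hi ⟨ω, hω, hT, rfl⟩
    rcases cs.length_mul_simple (cs.wordProd ω) i with h | h
    · refine ⟨ω ++ [i], ?_, ?_, ?_⟩
      · rw [CoxeterSystem.IsReduced, wordProd_append, wordProd_singleton, h, hω.eq]
        simp
      · simpa [or_imp, forall_and] using ⟨hT, hi⟩
      · simp [wordProd_append]
    · obtain ⟨j, hj, he⟩ := exists_eraseIdx_of_length_lt cs (cs.isReflection_simple i)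
        (ω := ω) (by omega)
      refine ⟨ω.eraseIdx j, ?_, fun k hk ↦ hT k (List.mem_of_mem_eraseIdx hk), he⟩
      have := List.length_eraseIdx_add_one hj
      rw [CoxeterSystem.IsReduced, ← he]
      have := hω.eq
      omega
  induction hw using Subgroup.closure_induction_right with
  | one => exact ⟨[], by simp [CoxeterSystem.IsReduced]⟩
  | mul_right x y hx ih hy =>
    obtain ⟨i, hi, rfl⟩ := ih
    exact step x i hi hy
  | mul_inv_cancel x y hx ih hy =>
    obtain ⟨i, hi, rfl⟩ := ih
    rw [cs.inv_simple]
    exact step x i hi hy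

theorem exists_rightDescent_of_mem_sp {T : Set B} {w : W} (hw : w ∈ sp cs T) (h1 : w ≠ 1) :
    ∃ i ∈ T, cs.length (w * cs.simple i) < cs.length w := by
  obtain ⟨ω, hω, hT, rfl⟩ := exists_isReduced_of_mem_sp cs hw
  rcases List.eq_nil_or_concat ω with rfl | ⟨ω', i, rfl⟩
  · simp at h1
  · refine ⟨i, hT i (by simp), ?_⟩
    rw [hω.eq]
    have := cs.length_wordProd_le ω'
    rw [wordProd_concat, simple_mul_simple_cancel_right, List.length_concat]
    omega

theorem simple_mem_sp_of_length_lt {T : Set B} {w : W} (hw : w ∈ sp cs T) {i : B}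
    (h : cs.length (w * cs.simple i) < cs.length w) : cs.simple i ∈ sp cs T := by
  obtain ⟨ω, -, hT, rfl⟩ := exists_isReduced_of_mem_sp cs hw
  obtain ⟨j, -, he⟩ := exists_eraseIdx_of_length_lt cs (cs.isReflection_simple i) h
  rw [← Subgroup.mul_mem_cancel_left _ hw, he]
  exact wordProd_mem_sp cs fun k hk ↦ hT k (List.mem_of_mem_eraseIdx hk)

theorem exists_eq_simple_of_length_eq_one {T : Set B} {w : W} (hw : w ∈ sp cs T)
    (h : cs.length w = 1) : ∃ i ∈ T, w = cs.simple i := by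
  obtain ⟨ω, hω, hT, rfl⟩ := exists_isReduced_of_mem_sp cs hw
  obtain ⟨i, rfl⟩ := List.length_eq_one_iff.1 (hω.eq.symm.trans h)
  exact ⟨i, hT i (by simp), by simp⟩

theorem simple_mem_sp_iff {T : Set B} {i : B} :
    cs.simple i ∈ sp cs T ↔ ∃ j ∈ T, cs.simple i = cs.simple j := by
  refine ⟨fun h ↦ exists_eq_simple_of_length_eq_one cs h (cs.length_simple i), ?_⟩
  rintro ⟨j, hj, h⟩
  exact h ▸ simple_mem_sp cs hj

theorem length_mul_of_forall_length_le {T : Set B} {d : W}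
    (hd : ∀ b ∈ sp cs T, cs.length d ≤ cs.length (d * b)) {b : W} (hb : b ∈ sp cs T) :
    cs.length (d * b) = cs.length d + cs.length b := by
  obtain ⟨ω, hω, hT, rfl⟩ := exists_isReduced_of_mem_sp cs hb
  clear hb
  induction ω using List.reverseRecOn with
  | nil => simp
  | append_singleton ω i ih =>
    have hr : cs.IsReduced ω := by simpa using hω.take ω.length
    have hTω : ∀ k ∈ ω, k ∈ T := fun k hk ↦ hT k (by simp [hk])
    have hi : i ∈ T := hT i (by simp)
    have ih := ih hr hTω
    have hlen := hω.eq
    rw [wordProd_append, wordProd_singleton, List.length_append, List.length_singleton,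
      ← hr.eq] at hlen
    rw [wordProd_append, wordProd_singleton, hlen, ← mul_assoc]
    rcases cs.length_mul_simple (d * cs.wordProd ω) i with h | h
    · omega
    · exfalso
      obtain ⟨δ, hδ, rfl⟩ := cs.exists_isReduced d
      obtain ⟨j, hj, he⟩ := exists_eraseIdx_of_length_lt cs (cs.isReflection_simple i)
        (ω := δ ++ ω) (by rw [wordProd_append]; omega)
      rw [List.length_append] at hj
      rcases lt_or_ge j δ.length with hjδ | hjδ
      · rw [List.eraseIdx_append_of_lt_length hjδ, wordProd_append, wordProd_append] at he
        have h1 := hd (cs.wordProd ω * cs.simple i * (cs.wordProd ω)⁻¹)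
          (mul_mem (mul_mem (wordProd_mem_sp cs hTω) (simple_mem_sp cs hi))
            (inv_mem (wordProd_mem_sp cs hTω)))
        rw [← mul_assoc, ← mul_assoc, he, mul_inv_cancel_right, hδ.eq] at h1
        have h2 := cs.length_wordProd_le (δ.eraseIdx j)
        have h3 := List.length_eraseIdx_add_one hjδ
        omega
      · rw [List.eraseIdx_append_of_length_le hjδ, wordProd_append, wordProd_append, mul_assoc,
          mul_right_inj] at he
        rw [he] at hlen
        have h2 := cs.length_wordProd_le (ω.eraseIdx (j - δ.length))
        have h3 := List.length_eraseIdx_add_one (l := ω) (i := j - δ.length) (by omega)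
        have := hr.eq
        omega

theorem length_mul_of_forall_length_le_left {T : Set B} {d : W}
    (hd : ∀ b ∈ sp cs T, cs.length d ≤ cs.length (b * d)) {b : W} (hb : b ∈ sp cs T) :
    cs.length (b * d) = cs.length b + cs.length d := by
  have h := length_mul_of_forall_length_le cs (T := T) (d := d⁻¹) (fun c hc ↦ by
    have h := hd c⁻¹ (inv_mem hc)
    rwa [← cs.length_inv d, ← cs.length_inv (c⁻¹ * d), mul_inv_rev, inv_inv] at h) (inv_mem hb)
  rw [← mul_inv_rev, cs.length_inv, cs.length_inv, cs.length_inv] at h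
  omega

theorem finite_setOf_length_le [Finite B] (n : ℕ) : {w : W | cs.length w ≤ n}.Finite := by
  refine ((List.finite_length_le B n).image cs.wordProd).subset fun w hw ↦ ?_
  obtain ⟨ω, hω, rfl⟩ := cs.exists_isReduced w
  exact ⟨ω, hω.eq.symm.trans_le hw, rfl⟩

end SpecialSubgroups

section Bruhat

variable {W : Type*} [Group W] {M : CoxeterMatrix B} (cs : CoxeterSystem M W)

/-- The relation generating the Bruhat order. -/
def BruhatStep (x y : W) : Prop :=
  ∃ t, cs.IsReflection t ∧ y = x * t ∧ cs.length x < cs.length y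

/-- The Bruhat order. -/
def BruhatLE : W → W → Prop := Relation.ReflTransGen (BruhatStep cs)

variable {cs}

theorem BruhatStep.inv {x y : W} (h : BruhatStep cs x y) : BruhatStep cs x⁻¹ y⁻¹ := by
  obtain ⟨t, ht, rfl, hl⟩ := h
  refine ⟨x * t * x⁻¹, ht.conj x, ?_, by rwa [cs.length_inv, cs.length_inv]⟩
  rw [mul_inv_rev, ht.inv]
  group

theorem BruhatLE.inv {x y : W} (h : BruhatLE cs x y) : BruhatLE cs x⁻¹ y⁻¹ :=
  Relation.ReflTransGen.lift (·⁻¹) (fun _ _ ↦ BruhatStep.inv) _ _ h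

theorem BruhatLE.length_le {x y : W} (h : BruhatLE cs x y) : cs.length x ≤ cs.length y := by
  induction h with
  | refl => rfl
  | tail _ h ih =>
    obtain ⟨t, -, -, hl⟩ := h
    omega

theorem BruhatStep.mul_simple {x y : W} (h : BruhatStep cs x y) (i : B) :
    BruhatStep cs (x * cs.simple i) (y * cs.simple i) ∨ x * cs.simple i = y := by
  obtain ⟨t, ht, rfl, hl⟩ := h
  by_cases hti : t = cs.simple i
  · exact Or.inr (by rw [hti])
  · refine Or.inl ⟨cs.simple i * t * cs.simple i, ?_, by simp [mul_assoc],
      length_mul_simple_lt_of_ne cs ht hti hl⟩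
    simpa using ht.conj (cs.simple i)

theorem BruhatLE.mul_simple_or {x y : W} (h : BruhatLE cs x y) (i : B) :
    BruhatLE cs (x * cs.simple i) y ∨ BruhatLE cs (x * cs.simple i) (y * cs.simple i) := by
  induction h using Relation.ReflTransGen.head_induction_on with
  | refl => exact Or.inr .refl
  | head h hle ih =>
    rcases h.mul_simple i with h' | h'
    · exact ih.imp (.head h') (.head h')
    · exact Or.inl (h' ▸ hle)

theorem BruhatLE.le_mul_simple_or {x y : W} (h : BruhatLE cs x y) (i : B) :
    BruhatLE cs x (y * cs.simple i) ∨ BruhatLE cs (x * cs.simple i) (y * cs.simple i) := by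
  induction h using Relation.ReflTransGen.head_induction_on with
  | refl => exact Or.inr .refl
  | head h hle ih =>
    rcases ih with ih | ih
    · exact Or.inl (.head h ih)
    · rcases h.mul_simple i with h' | h'
      · exact Or.inr (.head h' ih)
      · refine Or.inl ?_
        rwa [← h', simple_mul_simple_cancel_right] at ih

theorem BruhatLE.le_simple_mul_or {x y : W} (h : BruhatLE cs x y) (i : B) :
    BruhatLE cs x (cs.simple i * y) ∨ BruhatLE cs (cs.simple i * x) (cs.simple i * y) := by
  have := h.inv.le_mul_simple_or i
  exact this.imp (fun h ↦ by simpa using h.inv) (fun h ↦ by simpa using h.inv)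

end Bruhat

section FiniteIndex

variable {W : Type*} [Group W] {M : CoxeterMatrix B} (cs : CoxeterSystem M W)

theorem eq_one_of_mem_sp_of_mem_sp {T K : Set B} (hK : ∀ k ∈ K, cs.simple k ∉ sp cs T) {w : W}
    (hT : w ∈ sp cs T) (hw : w ∈ sp cs K) : w = 1 := by
  by_contra h1
  obtain ⟨k, hk, hlt⟩ := exists_rightDescent_of_mem_sp cs hw h1
  exact hK k hk (simple_mem_sp_of_length_lt cs hT hlt)

theorem length_mul_simple_of_notMem_sp {T : Set B} {u : B} (hu : cs.simple u ∉ sp cs T) {w : W}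
    (hw : w ∈ sp cs T) : cs.length (w * cs.simple u) = cs.length w + 1 := by
  have := cs.length_mul_simple w u
  have := mt (simple_mem_sp_of_length_lt cs hw (i := u)) hu
  omega

theorem mem_sp_commuting_of_conj_mem {T : Set B} {u : B} (hu : cs.simple u ∉ sp cs T) {n : W}
    (hn : n ∈ sp cs T) (hun : cs.simple u * n * cs.simple u ∈ sp cs T) :
    n ∈ sp cs {t ∈ T | Commute (cs.simple t) (cs.simple u)} := by
  induction hl : cs.length n using Nat.strong_induction_on generalizing n with
  | _ l ih =>
  subst hl
  by_cases h1 : n = 1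
  · exact h1 ▸ one_mem _
  obtain ⟨t, ht, hlt⟩ := exists_rightDescent_of_mem_sp cs hn h1
  have htT := simple_mem_sp cs ht
  obtain ⟨ω, hω, hωT, hωn⟩ := exists_isReduced_of_mem_sp cs hun
  have hwu : cs.wordProd (ω ++ [u]) = cs.simple u * n := by
    rw [wordProd_append, wordProd_singleton, ← hωn, simple_mul_simple_cancel_right]
  have hlen : cs.length (cs.simple u * n) = cs.length n + 1 := by
    rw [← cs.length_inv, mul_inv_rev, cs.inv_simple,
      length_mul_simple_of_notMem_sp cs hu (inv_mem hn), cs.length_inv]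
  obtain ⟨j, hj, he⟩ := exists_eraseIdx_of_length_lt cs (cs.isReflection_simple t)
    (ω := ω ++ [u]) (by
      rw [hwu, hlen, mul_assoc]
      have := cs.length_mul_le (cs.simple u) (n * cs.simple t)
      rw [cs.length_simple] at this
      omega)
  have hr : cs.simple u * cs.simple t * cs.simple u ∈ sp cs T := by
    rw [List.length_append, List.length_singleton] at hj
    rcases lt_or_ge j ω.length with hj' | hj'
    · rw [List.eraseIdx_append_of_lt_length hj', wordProd_append, wordProd_append,
        wordProd_singleton, mul_assoc, ← eq_inv_mul_iff_mul_eq] at he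
      rw [he]
      simp only [mul_assoc, simple_mul_simple_self, mul_one]
      exact mul_mem (inv_mem (wordProd_mem_sp cs hωT))
        (wordProd_mem_sp cs fun k hk ↦ hωT k (List.mem_of_mem_eraseIdx hk))
    · obtain rfl : j = ω.length := by omega
      rw [List.eraseIdx_append_of_length_le le_rfl] at he
      simp only [tsub_self, List.eraseIdx_cons_zero, List.append_nil, wordProd_append,
        wordProd_singleton, mul_assoc, mul_eq_left] at he
      rw [← cs.inv_simple u, inv_mul_eq_one] at he
      exact absurd (he ▸ htT) hu
  have hcomm : cs.simple u * cs.simple t * cs.simple u = cs.simple t := by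
    have hr1 : cs.length (cs.simple u * cs.simple t * cs.simple u) = 1 := by
      have h := length_mul_simple_of_notMem_sp cs hu hr
      have h2 := cs.length_mul_le (cs.simple u) (cs.simple t)
      rw [simple_mul_simple_cancel_right] at h
      rw [cs.length_simple, cs.length_simple] at h2
      have h3 : cs.length (cs.simple u * cs.simple t * cs.simple u) ≠ 0 := by
        rw [Ne, cs.length_eq_zero_iff]
        intro h0
        have := (cs.isReflection_simple t).conj (cs.simple u)
        rw [cs.inv_simple, h0] at this
        have := this.odd_length
        simp at this
      omega
    have hmem : cs.simple u * cs.simple t * cs.simple u ∈ sp cs {t, u} :=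
      mul_mem (mul_mem (simple_mem_sp cs (by simp)) (simple_mem_sp cs (by simp)))
        (simple_mem_sp cs (by simp))
    obtain ⟨k, rfl | rfl, hkeq⟩ := exists_eq_simple_of_length_eq_one cs hmem hr1
    · exact hkeq
    · exact absurd (hkeq ▸ hr) hu
  have htu : Commute (cs.simple t) (cs.simple u) := by
    rw [Commute, SemiconjBy]
    nth_rw 1 [← hcomm]
    simp
  have hrec := ih _ hlt (n := n * cs.simple t) (mul_mem hn htT) (by
    have : cs.simple u * (n * cs.simple t) * cs.simple u =
        cs.simple u * n * cs.simple u * (cs.simple u * cs.simple t * cs.simple u) := by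
      simp [mul_assoc]
    rw [this]
    exact mul_mem hun hr) rfl
  rw [← simple_mul_simple_cancel_right cs t (w := n)]
  exact mul_mem hrec (simple_mem_sp cs ⟨ht, htu⟩)

theorem exists_commuting_of_finite_quotient [Finite B] {I X : Set B}
    [Finite (sp cs X ⧸ (sp cs I).subgroupOf (sp cs X))] :
    ∃ T ⊆ I, (∀ t ∈ T, ∀ u ∈ X, cs.simple u ∉ sp cs T → Commute (cs.simple t) (cs.simple u)) ∧
      Finite (sp cs {u ∈ X | cs.simple u ∉ sp cs T}) := by
  set H := (sp cs I).subgroupOf (sp cs X) with hH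
  have : H.FiniteIndex := Subgroup.finiteIndex_of_finite_quotient
  obtain ⟨T, hTmin⟩ := (Set.toFinite {T : Set B | T ⊆ I ∧
    ∀ n ∈ H.normalCore, (n : W) ∈ sp cs T}).exists_minimal
    ⟨I, subset_rfl, fun n hn ↦ Subgroup.mem_subgroupOf.1 (H.normalCore_le hn)⟩
  obtain ⟨⟨hTI, hT⟩, hmin⟩ := hTmin
  refine ⟨T, hTI, fun t ht u hu huT ↦ ?_, ?_⟩
  · refine (hmin (y := {t ∈ T | Commute (cs.simple t) (cs.simple u)})
      ⟨(Set.sep_subset _ _).trans hTI, fun n hn ↦ ?_⟩ (Set.sep_subset _ _) ht).2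
    refine mem_sp_commuting_of_conj_mem cs huT (hT n hn) ?_
    simpa using hT _ (H.normalCore_normal.conj_mem n hn ⟨cs.simple u, simple_mem_sp cs hu⟩)
  · have hle : sp cs {u ∈ X | cs.simple u ∉ sp cs T} ≤ sp cs X :=
      sp_mono cs (Set.sep_subset _ _)
    refine Finite.of_injective
      (fun a ↦ (QuotientGroup.mk (Subgroup.inclusion hle a) : sp cs X ⧸ H.normalCore))
      fun a b hab ↦ ?_
    have hn := hT _ (QuotientGroup.eq.1 hab)
    have h1 : (a : W)⁻¹ * b = 1 :=
      eq_one_of_mem_sp_of_mem_sp cs (fun k hk ↦ hk.2) (by simpa using hn)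
        (mul_mem (inv_mem a.2) b.2)
    exact Subtype.ext (inv_mul_eq_one.1 h1)

theorem finite_quotient_of_conj_subset [Finite B] {I : Set B} {s : B} {v : W}
    (hv : v ∈ sp cs (insert s I)) (hv1 : v ≠ 1)
    (hmin : ∀ i ∈ I, cs.length v < cs.length (cs.simple i * v))
    (hconj : ∀ i ∈ I, ∃ j ∈ insert s I, v⁻¹ * cs.simple i * v = cs.simple j) :
    Finite (sp cs (insert s I) ⧸ (sp cs I).subgroupOf (sp cs (insert s I))) := by
  classical
  have hdesc : ∀ t ∈ insert s I, cs.length (v * cs.simple t) < cs.length v ∨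
      ∃ i ∈ I, v * cs.simple t = cs.simple i * v := by
    set F : Finset W := (I.toFinite.image cs.simple).toFinset with hF
    have hFmem : ∀ x, x ∈ F ↔ ∃ i ∈ I, cs.simple i = x := by simp [hF]
    set f : W → W := fun x ↦ v⁻¹ * x * v with hf
    have hfinj : Function.Injective f := fun a b h ↦ by simpa [hf] using h
    have hX : ∀ t ∈ insert s I, cs.simple t ∈ insert (cs.simple s) F := by
      rintro t (rfl | ht)
      · simp
      · exact Finset.mem_insert_of_mem ((hFmem _).2 ⟨t, ht, rfl⟩)
    obtain ⟨t₀, ht₀, hlt⟩ := exists_rightDescent_of_mem_sp cs hv hv1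
    intro t ht
    by_cases hc : cs.simple t ∈ F.image f
    · right
      obtain ⟨x, hx, hxt⟩ := Finset.mem_image.1 hc
      obtain ⟨i, hi, rfl⟩ := (hFmem _).1 hx
      refine ⟨i, hi, ?_⟩
      rw [← hxt]
      simp [hf, mul_assoc]
    · left
      have ht₀c : cs.simple t₀ ∉ F.image f := by
        intro hc
        obtain ⟨x, hx, hxt⟩ := Finset.mem_image.1 hc
        obtain ⟨i, hi, rfl⟩ := (hFmem _).1 hx
        have := hmin i hi
        rw [← hxt] at hlt
        simp only [hf, mul_assoc, mul_inv_cancel_left] at hlt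
        omega
      have hsub : F.image f ⊆ (insert (cs.simple s) F).erase (cs.simple t₀) := by
        intro y hy
        refine Finset.mem_erase.2 ⟨fun h ↦ ht₀c (h ▸ hy), ?_⟩
        obtain ⟨x, hx, rfl⟩ := Finset.mem_image.1 hy
        obtain ⟨i, hi, rfl⟩ := (hFmem _).1 hx
        obtain ⟨j, hj, hij⟩ := hconj i hi
        simp only [hf, hij]
        exact hX j hj
      have heq := Finset.eq_of_subset_of_card_le hsub (by
        rw [Finset.card_image_of_injective _ hfinj, Finset.card_erase_of_mem (hX _ ht₀)]
        have := Finset.card_insert_le (cs.simple s) F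
        omega)
      rw [heq, Finset.mem_erase] at hc
      have : cs.simple t = cs.simple t₀ := by
        by_contra hne
        exact hc ⟨hne, hX t ht⟩
      rwa [this]
  have hstep : ∀ z : W, (∃ a ∈ sp cs I, BruhatLE cs (a * z) v) → ∀ t ∈ insert s I,
      ∃ a ∈ sp cs I, BruhatLE cs (a * (z * cs.simple t)) v := by
    rintro z ⟨a, ha, hle⟩ t ht
    rcases hle.mul_simple_or t with h | h
    · exact ⟨a, ha, by rwa [← mul_assoc]⟩
    · rcases hdesc t ht with hlt | ⟨i, hi, hvi⟩
      · refine ⟨a, ha, ?_⟩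
        rw [← mul_assoc]
        exact h.tail ⟨cs.simple t, cs.isReflection_simple t, by simp, hlt⟩
      · rw [hvi] at h
        rcases h.le_simple_mul_or i with h | h <;> rw [simple_mul_simple_cancel_left] at h
        · exact ⟨a, ha, by rwa [← mul_assoc]⟩
        · exact ⟨cs.simple i * a, mul_mem (simple_mem_sp cs hi) ha, by simpa [mul_assoc] using h⟩
  have hall : ∀ x ∈ sp cs (insert s I), ∃ a ∈ sp cs I, BruhatLE cs (a * (v * x)) v := by
    intro x hx
    induction hx using Subgroup.closure_induction_right with
    | one => exact ⟨1, one_mem _, by rw [one_mul, mul_one]; exact .refl⟩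
    | mul_right x y hx hy ih =>
      obtain ⟨t, ht, rfl⟩ := hy
      simpa only [mul_assoc] using hstep _ ih t ht
    | mul_inv_cancel x y hx hy ih =>
      obtain ⟨t, ht, rfl⟩ := hy
      rw [cs.inv_simple]
      simpa only [mul_assoc] using hstep _ ih t ht
  have hfin : Finite {x : sp cs (insert s I) // cs.length (x : W) ≤ cs.length v} :=
    ((finite_setOf_length_le cs (cs.length v)).preimage Subtype.val_injective.injOn).to_subtype
  refine Finite.of_surjective (fun x : {x : sp cs (insert s I) //
    cs.length (x : W) ≤ cs.length v} ↦ QuotientGroup.mk (x.1⁻¹)) fun q ↦ ?_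
  obtain ⟨z, rfl⟩ := QuotientGroup.mk_surjective q
  obtain ⟨a, ha, hle⟩ := hall (v⁻¹ * (z : W)⁻¹) (mul_mem (inv_mem hv) (inv_mem z.2))
  rw [mul_inv_cancel_left] at hle
  refine ⟨⟨⟨a * (z : W)⁻¹, mul_mem (sp_mono cs (Set.subset_insert _ _) ha) (inv_mem z.2)⟩,
    hle.length_le⟩, ?_⟩
  rw [QuotientGroup.eq, Subgroup.mem_subgroupOf]
  simpa using ha

end FiniteIndex

section Spherical

variable {W : Type*} [Group W] {M : CoxeterMatrix B} (cs : CoxeterSystem M W)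

theorem finite_sp_union_of_commute {U V : Set B} (hU : Finite (sp cs U)) (hV : Finite (sp cs V))
    (h : ∀ a ∈ U, ∀ b ∈ V, Commute (cs.simple a) (cs.simple b)) :
    Finite (sp cs (U ∪ V)) := by
  have hcomm : ∀ (x : sp cs U) (y : sp cs V), Commute (x : W) (y : W) := by
    rintro ⟨x, hx⟩ ⟨y, hy⟩
    have hx' := Subgroup.closure_le_centralizer_centralizer _ hx
    have hy' : y ∈ Subgroup.centralizer (cs.simple '' U) := by
      refine (Subgroup.closure_le _).2 ?_ hy
      rintro _ ⟨b, hb, rfl⟩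
      rw [SetLike.mem_coe, Subgroup.mem_centralizer_iff]
      rintro _ ⟨a, ha, rfl⟩
      exact (h a ha b hb).eq
    exact (Subgroup.mem_centralizer_iff.1 hx' y hy').symm
  have hrange := MonoidHom.noncommCoprod_range (f := (sp cs U).subtype)
    (g := (sp cs V).subtype) hcomm
  rw [Subgroup.range_subtype, Subgroup.range_subtype] at hrange
  rw [sp, Set.image_union, Subgroup.closure_union]
  change Finite ↥(sp cs U ⊔ sp cs V)
  rw [← hrange]
  exact Finite.of_surjective _ (MonoidHom.rangeRestrict_surjective _)

theorem isSpherical_insert [Finite B] {n : ℕ} {I : Set B} {s : B} (hs : cs.simple s ∉ sp cs I)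
    (hI : IsSpherical cs n I)
    [Finite (sp cs (insert s I) ⧸ (sp cs I).subgroupOf (sp cs (insert s I)))] :
    IsSpherical cs n (insert s I) := by
  classical
  obtain ⟨T, hTI, hcomm, hfin⟩ := exists_commuting_of_finite_quotient cs (I := I)
    (X := insert s I)
  intro U hU hcard
  have hUT : ∀ k, cs.simple k ∈ sp cs T → cs.simple k ∈ cs.simple '' T := by
    intro k hk
    obtain ⟨j, hj, hkj⟩ := (simple_mem_sp_iff cs).1 hk
    exact ⟨j, hj, hkj.symm⟩
  have h1 : Finite (sp cs (↑(U.filter (cs.simple · ∈ sp cs T)) : Set B)) := by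
    refine hI _ (fun k hk ↦ ?_) ((Finset.card_filter_le _ _).trans hcard)
    obtain ⟨hkU, hkT⟩ := Finset.mem_filter.1 hk
    rcases hU hkU with rfl | hkI
    · exact absurd (sp_mono cs hTI hkT) hs
    · exact hkI
  have h2 : Finite (sp cs (↑(U.filter (cs.simple · ∉ sp cs T)) : Set B)) := by
    refine Finite.of_injective _ (Subgroup.inclusion_injective (sp_mono cs fun k hk ↦ ?_ :
      _ ≤ sp cs {u ∈ insert s I | cs.simple u ∉ sp cs T}))
    obtain ⟨hkU, hkT⟩ := Finset.mem_filter.1 hk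
    exact ⟨hU hkU, hkT⟩
  have h3 := finite_sp_union_of_commute cs h1 h2 fun a ha b hb ↦ by
    obtain ⟨haU, haT⟩ := Finset.mem_filter.1 ha
    obtain ⟨hbU, hbT⟩ := Finset.mem_filter.1 hb
    obtain ⟨t, ht, hta⟩ := hUT a haT
    exact hta ▸ hcomm t ht b (hU hbU) hbT
  rwa [← Finset.coe_union, Finset.filter_union_filter_not_eq] at h3

/-- A maximal `n`-spherical special subgroup is contained in `d W_J d⁻¹` for `d` of minimal length
in its double coset only when `d = 1`. -/
theorem eq_one_of_isMaxSpherical [Finite B] {n : ℕ} {I J : Set B} (hI : IsMaxSpherical cs n I)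
    {d : W} (hd : ∀ a ∈ sp cs I, ∀ b ∈ sp cs J, cs.length d ≤ cs.length (a * d * b))
    (hsub : ∀ i ∈ I, d⁻¹ * cs.simple i * d ∈ sp cs J) : d = 1 := by
  by_contra hd1
  have hlen : ∀ i ∈ I, cs.length (cs.simple i * d) = cs.length d + 1 := by
    intro i hi
    have := hd _ (simple_mem_sp cs hi) 1 (one_mem _)
    rw [mul_one] at this
    have := cs.length_simple_mul d i
    omega
  have hconj : ∀ i ∈ I, ∃ j, cs.simple i * d = d * cs.simple j := by
    intro i hi
    have h := length_mul_of_forall_length_le cs (T := J) (d := d)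
      (fun b hb ↦ by simpa using hd 1 (one_mem _) b hb) (hsub i hi)
    rw [mul_assoc, mul_inv_cancel_left, hlen i hi] at h
    obtain ⟨j, -, hj⟩ := exists_eq_simple_of_length_eq_one cs (hsub i hi)
      (by rw [mul_assoc]; omega)
    exact ⟨j, by rw [← hj]; group⟩
  obtain ⟨s, hs⟩ := cs.exists_leftDescent_of_ne_one hd1
  rw [CoxeterSystem.IsLeftDescent] at hs
  have hsI : cs.simple s ∉ sp cs I := by
    intro h
    have := hd _ h 1 (one_mem _)
    rw [mul_one] at this
    omega
  obtain ⟨⟨v', hv'⟩, hmin⟩ : ∃ x : sp cs (insert s I), ∀ y : sp cs (insert s I),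
      cs.length ((x : W) * d) ≤ cs.length ((y : W) * d) :=
    ⟨_, fun y ↦ Function.argmin_le (fun x : sp cs (insert s I) ↦ cs.length ((x : W) * d)) y⟩
  have hd' : ∀ b ∈ sp cs (insert s I), cs.length (v' * d) ≤ cs.length (b * (v' * d)) := by
    intro b hb
    rw [← mul_assoc]
    exact hmin ⟨b * v', mul_mem hb hv'⟩
  have hadd := fun b hb ↦ length_mul_of_forall_length_le_left cs hd' (b := b) hb
  have hv := inv_mem hv'
  have hdv : cs.length d = cs.length v'⁻¹ + cs.length (v' * d) := by
    rw [← hadd _ hv, inv_mul_cancel_left]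
  have hmul : ∀ k ∈ insert s I, cs.length (cs.simple k * d) =
      cs.length (cs.simple k * v'⁻¹) + cs.length (v' * d) := by
    intro k hk
    rw [← hadd _ (mul_mem (simple_mem_sp cs hk) hv), mul_assoc, inv_mul_cancel_left]
  have hfin := finite_quotient_of_conj_subset cs (I := I) (s := s) hv
    (fun h1 ↦ by
      have := hmul s (Set.mem_insert _ _)
      rw [h1] at this hdv
      simp at this hdv
      omega)
    (fun i hi ↦ by
      have := hmul i (Set.mem_insert_of_mem _ hi)
      have := hlen i hi
      omega)
    (fun i hi ↦ by
      have hxm : v'⁻¹⁻¹ * cs.simple i * v'⁻¹ ∈ sp cs (insert s I) :=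
        mul_mem (mul_mem (inv_mem hv) (simple_mem_sp cs (Set.mem_insert_of_mem _ hi))) hv
      refine exists_eq_simple_of_length_eq_one cs hxm ?_
      obtain ⟨j, hj⟩ := hconj i hi
      have h1 := hadd _ hxm
      have h2 : v'⁻¹⁻¹ * cs.simple i * v'⁻¹ * (v' * d) = v' * d * cs.simple j := by
        rw [mul_assoc v', ← hj]
        group
      have h3 := cs.length_mul_simple (v' * d) j
      have h4 : Odd (cs.length (v'⁻¹⁻¹ * cs.simple i * v'⁻¹)) := by
        simpa using ((cs.isReflection_simple i).conj v').odd_length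
      rw [h2] at h1
      obtain ⟨m, hm⟩ := h4
      omega)
  refine hI.2 _ (isSpherical_insert cs hsI hI.1) (lt_of_le_not_ge
    (sp_mono cs (Set.subset_insert s I)) fun h ↦ hsI (h (simple_mem_sp cs (Set.mem_insert s I))))

theorem sp_eq_conjSub_of_le [Finite B] {n : ℕ} {I J : Set B} (hI : IsMaxSpherical cs n I)
    (hJ : IsSpherical cs n J) (w : W) (hsub : sp cs I ≤ conjSub w (sp cs J)) :
    sp cs I = conjSub w (sp cs J) := by
  have hsub' : ∀ x ∈ sp cs I, w⁻¹ * x * w ∈ sp cs J := by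
    intro x hx
    obtain ⟨y, hy, rfl⟩ := Subgroup.mem_map.1 (hsub hx)
    simpa [mul_assoc] using hy
  obtain ⟨⟨⟨a, ha⟩, ⟨b, hb⟩⟩, hmin⟩ : ∃ x : sp cs I × sp cs J, ∀ y : sp cs I × sp cs J,
      cs.length ((x.1 : W) * w * x.2) ≤ cs.length ((y.1 : W) * w * y.2) :=
    ⟨_, fun y ↦ Function.argmin_le
      (fun x : sp cs I × sp cs J ↦ cs.length ((x.1 : W) * w * x.2)) y⟩
  have h1 : a * w * b = 1 := by
    refine eq_one_of_isMaxSpherical cs hI (J := J) (fun a' ha' b' hb' ↦ ?_) fun i hi ↦ ?_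
    · have := hmin ⟨⟨a' * a, mul_mem ha' ha⟩, ⟨b * b', mul_mem hb hb'⟩⟩
      simpa only [mul_assoc] using this
    · have := mul_mem (mul_mem (inv_mem hb)
        (hsub' _ (mul_mem (mul_mem (inv_mem ha) (simple_mem_sp cs hi)) ha))) hb
      simpa [mul_assoc] using this
  have hw : w = a⁻¹ * b⁻¹ := by
    rw [mul_eq_one_iff_eq_inv] at h1
    rw [← h1, inv_mul_cancel_left]
  have hle : sp cs I ≤ sp cs J := by
    intro x hx
    have := hsub' _ (mul_mem (mul_mem (inv_mem ha) hx) ha)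
    rw [hw] at this
    have := mul_mem (mul_mem (inv_mem hb) this) hb
    simpa [mul_assoc] using this
  have heq : sp cs I = sp cs J := hle.eq_of_not_lt (hI.2 J hJ)
  have hwJ : w ∈ sp cs J := hw ▸ mul_mem (inv_mem (heq ▸ ha)) (inv_mem hb)
  refine le_antisymm hsub ?_
  rintro _ ⟨y, hy, rfl⟩
  rw [heq]
  exact mul_mem (mul_mem hwJ hy) (inv_mem hwJ)

end Spherical

/-- If `A` is a maximal `(n+1)`-spherical special subgroup of `W`, `B` is an
`(n+1)`-spherical special subgroup, and `A ⊆ w B w⁻¹`, then `A = w B w⁻¹`.  In particular,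
for every `u ∈ W`, if `A ⊆ u A u⁻¹` then `A = u A u⁻¹`. -/
theorem stmt_13 {W : Type*} [Group W] [Fintype B] {M : CoxeterMatrix B}
    (cs : CoxeterSystem M W) (n : ℕ) (SA SB : Set B)
    (hA : IsMaxSpherical cs (n + 1) SA) (hB : IsSpherical cs (n + 1) SB)
    (w : W) (hsub : sp cs SA ≤ conjSub w (sp cs SB)) :
    sp cs SA = conjSub w (sp cs SB) ∧
    ∀ u : W, sp cs SA ≤ conjSub u (sp cs SA) → sp cs SA = conjSub u (sp cs SA) :=
  ⟨sp_eq_conjSub_of_le cs hA hB w hsub, fun u hu ↦ sp_eq_conjSub_of_le cs hA hA.1 u hu⟩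

end CoxFA
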